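/- arXiv:1803.04441 — 2 statements merged into one kernel-verified Lean document; each statement's English description precedes it below -/
import Mathlib

section
/- If S[S,S] = 0, then the Lie algebra (S[t], ⟨a,b⟩ := b′a − a′b) satisfies the standard identity of degree 6: St₆(x₁,…,x₅,z) = ∑_{σ ∈ Sym(5)} sgn(σ) ⟨x_{σ(1)}, ⟨x_{σ(2)}, ⟨x_{σ(3)}, ⟨x_{σ(4)}, ⟨x_{σ(5)}, z⟩⟩⟩⟩⟩ = 0 for all x₁, …, x₅, z ∈ S[t]. -/
noncomputable section

variable (K : Type*) [Field K] [CharZero K]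
variable (S : Type*) [NonUnitalRing S] [Module K S] [SMulCommClass K S S] [IsScalarTower K S S]

/-- The polynomial algebra `S[t]` over the (possibly nonunital, noncommutative)
`K`-algebra `S`, realized as the non-unital subalgebra of `(Unitization K S)[t]`
consisting of polynomials all of whose coefficients lie in `S`. -/
def polyS : NonUnitalSubalgebra K (Polynomial (Unitization K S)) where
  carrier := {p | ∀ n, (p.coeff n).fst = 0}
  add_mem' := by intro a b ha hb n; simp [ha n, hb n]
  zero_mem' := by intro n; simp
  mul_mem' := by
    intro a b ha hb n
    rw [Set.mem_setOf_eq] at *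
    rw [Polynomial.coeff_mul]
    have : ∀ (s : Finset (ℕ × ℕ)) (f : ℕ × ℕ → Unitization K S),
        (∑ x ∈ s, f x).fst = ∑ x ∈ s, (f x).fst := by
      intro s f
      induction s using Finset.cons_induction with
      | empty => simp
      | cons a t hat ih => rw [Finset.sum_cons, Finset.sum_cons, Unitization.fst_add, ih]
    rw [this]
    exact Finset.sum_eq_zero fun p _ => by rw [Unitization.fst_mul, ha p.1, zero_mul]
  smul_mem' := by intro c x hx n; simp [hx n]

variable {K S}

/-- The element `s·tⁿ` of `S[t]`. -/
def polyS.single (n : ℕ) (s : S) : polyS K S :=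
  ⟨Polynomial.monomial n (Unitization.inr s), by
    intro k
    simp only [Polynomial.coeff_monomial]
    split <;> simp⟩

/-- The formal derivative `d/dt` on `S[t]`. -/
def polyS.deriv (p : polyS K S) : polyS K S :=
  ⟨Polynomial.derivative (p : Polynomial (Unitization K S)), by
    intro n
    have h : ∀ k, ((p : Polynomial (Unitization K S)).coeff k).fst = 0 := p.2
    rw [Polynomial.coeff_derivative, Unitization.fst_mul, h (n + 1), zero_mul]⟩

/-- The bracket `⟨a,b⟩ := b′a − a′b` on `S[t]`. -/
def polyS.bracket (a b : polyS K S) : polyS K S :=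
  polyS.deriv b * a - polyS.deriv a * b



section Helpers

variable {R : Type*} [Ring R]

/-- Evaluation of a letter: `(none, k)` is the `k`-th derivative of `z`, and
`(some j, k)` is the `k`-th derivative of `x (σ j)`. -/
def lett (D : R →+ R) (x : Fin 5 → R) (z : R) (σ : Equiv.Perm (Fin 5))
    (p : Option (Fin 5) × ℕ) : R :=
  D^[p.2] (p.1.elim z (fun j => x (σ j)))

/-- Span of words using the letters `m` with `n` derivatives in total. -/
def wspan (D : R →+ R) (x : Fin 5 → R) (z : R) (m : Multiset (Option (Fin 5))) (n : ℕ) :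
    AddSubgroup (Equiv.Perm (Fin 5) → R) :=
  AddSubgroup.closure {F | ∃ l : List (Option (Fin 5) × ℕ),
    ((l.map Prod.fst : List _) : Multiset (Option (Fin 5))) = m ∧ (l.map Prod.snd).sum = n ∧
    F = fun σ => (l.map (lett D x z σ)).prod}

theorem wspan_mul_right (D : R →+ R) (x : Fin 5 → R) (z : R) {m : Multiset (Option (Fin 5))}
    {n : ℕ} (i : Option (Fin 5)) (k : ℕ) {F : Equiv.Perm (Fin 5) → R}
    (hF : F ∈ wspan D x z m n) :
    (fun σ => F σ * lett D x z σ (i, k)) ∈ wspan D x z (i ::ₘ m) (n + k) := by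
  unfold wspan at hF
  induction hF using AddSubgroup.closure_induction with
  | mem F h =>
    obtain ⟨l, h1, h2, rfl⟩ := h
    refine AddSubgroup.subset_closure ⟨l ++ [(i, k)], ?_, ?_, ?_⟩
    · rw [← h1, Multiset.cons_coe, Multiset.coe_eq_coe]
      simpa using List.perm_append_singleton i (l.map Prod.fst)
    · simp [h2]
    · funext σ; simp
  | zero =>
    convert AddSubgroup.zero_mem (wspan D x z (i ::ₘ m) (n + k)) using 1
    funext σ
    simp
  | add F G _ _ hF hG => simpa [add_mul] using! AddSubgroup.add_mem _ hF hG
  | neg F _ hF =>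
    convert AddSubgroup.neg_mem _ hF using 1
    funext σ
    simp

theorem wspan_mul_left (D : R →+ R) (x : Fin 5 → R) (z : R) {m : Multiset (Option (Fin 5))}
    {n : ℕ} (i : Option (Fin 5)) (k : ℕ) {F : Equiv.Perm (Fin 5) → R}
    (hF : F ∈ wspan D x z m n) :
    (fun σ => lett D x z σ (i, k) * F σ) ∈ wspan D x z (i ::ₘ m) (n + k) := by
  unfold wspan at hF
  induction hF using AddSubgroup.closure_induction with
  | mem F h =>
    obtain ⟨l, h1, h2, rfl⟩ := h
    refine AddSubgroup.subset_closure ⟨(i, k) :: l, ?_, ?_, ?_⟩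
    · rw [← h1, Multiset.cons_coe]; rfl
    · simp [h2, add_comm]
    · funext σ; simp
  | zero =>
    convert AddSubgroup.zero_mem (wspan D x z (i ::ₘ m) (n + k)) using 1
    funext σ
    simp
  | add F G _ _ hF hG => simpa [mul_add] using! AddSubgroup.add_mem _ hF hG
  | neg F _ hF =>
    convert AddSubgroup.neg_mem _ hF using 1
    funext σ
    simp

theorem wspan_deriv (D : R →+ R) (hD : ∀ a b, D (a * b) = D a * b + a * D b)
    (x : Fin 5 → R) (z : R) {m : Multiset (Option (Fin 5))}
    {n : ℕ} {F : Equiv.Perm (Fin 5) → R}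
    (hF : F ∈ wspan D x z m n) :
    (fun σ => D (F σ)) ∈ wspan D x z m (n + 1) := by
  unfold wspan at hF
  induction hF using AddSubgroup.closure_induction with
  | mem F h =>
    obtain ⟨l, h1, h2, rfl⟩ := h
    subst h1 h2
    induction l with
    | nil =>
      have h1 : D 1 = 0 := by simpa using hD 1 1
      convert AddSubgroup.zero_mem (wspan D x z _ _) using 1
      funext σ
      simp [h1]
    | cons a l ih =>
      have e : (fun σ => D (((a :: l).map (lett D x z σ)).prod)) =
          (fun σ => lett D x z σ (a.1, a.2 + 1) * (l.map (lett D x z σ)).prod) +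
          (fun σ => lett D x z σ (a.1, a.2) * D (l.map (lett D x z σ)).prod) := by
        funext σ
        simp only [List.map_cons, List.prod_cons, hD, Pi.add_apply]
        simp only [lett, Function.iterate_succ_apply']
      rw [e]
      refine AddSubgroup.add_mem _ ?_ ?_
      · have hl : (fun σ => (l.map (lett D x z σ)).prod) ∈
            wspan D x z ((l.map Prod.fst : List _) : Multiset (Option (Fin 5)))
              (l.map Prod.snd).sum :=
          AddSubgroup.subset_closure ⟨l, rfl, rfl, rfl⟩
        have := wspan_mul_left D x z a.1 (a.2 + 1) hl
        convert this using 1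
        simp only [List.map_cons, List.sum_cons]
        congr 1
        omega
      · have := wspan_mul_left D x z a.1 a.2 ih
        convert this using 1
        simp only [List.map_cons, List.sum_cons]
        congr 1
        omega
  | zero =>
    convert AddSubgroup.zero_mem (wspan D x z m (n + 1)) using 1
    funext σ
    simp
  | add F G _ _ hF hG => simpa using! AddSubgroup.add_mem _ hF hG
  | neg F _ hF =>
    convert AddSubgroup.neg_mem _ hF using 1
    funext σ
    simp

theorem wspan_bracket (D : R →+ R) (hD : ∀ a b, D (a * b) = D a * b + a * D b)
    (x : Fin 5 → R) (z : R) {m : Multiset (Option (Fin 5))}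
    {n : ℕ} {F : Equiv.Perm (Fin 5) → R} (i : Fin 5)
    (hF : F ∈ wspan D x z m n) :
    (fun σ => D (F σ) * x (σ i) - D (x (σ i)) * F σ) ∈ wspan D x z (some i ::ₘ m) (n + 1) :=
  AddSubgroup.sub_mem _ (wspan_mul_right D x z (some i) 0 (wspan_deriv D hD x z hF))
    (wspan_mul_left D x z (some i) 1 hF)

theorem prod_perm (A : Set R) (hA : ∀ a ∈ A, ∀ b ∈ A, a * b ∈ A)
    (hc : ∀ a ∈ A, ∀ b ∈ A, ∀ c ∈ A, a * (b * c) = a * (c * b))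
    {l₁ l₂ : List R} (h : l₁.Perm l₂) :
    (∀ a ∈ l₁, a ∈ A) → ∀ a ∈ A, a * l₁.prod = a * l₂.prod := by
  induction h with
  | nil => intros; rfl
  | cons b _ ih =>
    intro h a ha
    simp only [List.prod_cons, ← mul_assoc]
    exact ih (fun c hc => h c (by simp [hc])) _ (hA _ ha _ (h b (by simp)))
  | swap b c l =>
    intro h a ha
    simp only [List.prod_cons, ← mul_assoc]
    congr 1
    simpa only [mul_assoc] using hc a ha c (h c (by simp)) b (h b (by simp))
  | trans h1 _ ih1 ih2 =>
    intro h a ha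
    rw [ih1 h a ha, ih2 (fun c hc => h c (h1.mem_iff.2 hc)) a ha]

theorem pigeon (k : Fin 5 → ℕ) (hk : ∑ i, k i ≤ 5) (h : Option (Fin 5)) :
    ∃ i j, i ≠ j ∧ some i ≠ h ∧ some j ≠ h ∧ k i = k j := by
  by_contra! H
  simp only [Fin.sum_univ_five] at hk
  have h01 := H 0 1 (by decide)
  have h02 := H 0 2 (by decide)
  have h03 := H 0 3 (by decide)
  have h04 := H 0 4 (by decide)
  have h12 := H 1 2 (by decide)
  have h13 := H 1 3 (by decide)
  have h14 := H 1 4 (by decide)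
  have h23 := H 2 3 (by decide)
  have h24 := H 2 4 (by decide)
  have h34 := H 3 4 (by decide)
  clear H
  rcases h with _ | h
  · simp at h01 h02 h03 h12 h13 h23
    omega
  · fin_cases h <;> simp at h01 h02 h03 h04 h12 h13 h14 h23 h24 h34 <;> omega

theorem word_alt (D : R →+ R) (x : Fin 5 → R) (z : R)
    (A : Set R) (hA : ∀ a ∈ A, ∀ b ∈ A, a * b ∈ A) (hAD : ∀ a ∈ A, D a ∈ A)
    (hc : ∀ a ∈ A, ∀ b ∈ A, ∀ c ∈ A, a * (b * c) = a * (c * b))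
    (hx : ∀ i, x i ∈ A) (hz : z ∈ A)
    (l : List (Option (Fin 5) × ℕ)) (hnd : (l.map Prod.fst).Nodup)
    (hall : ∀ i : Fin 5, some i ∈ l.map Prod.fst) (hs : (l.map Prod.snd).sum = 5) :
    ∑ σ : Equiv.Perm (Fin 5), ((Equiv.Perm.sign σ : ℤˣ) : ℤ) •
      (l.map (lett D x z σ)).prod = 0 := by
  have hlett : ∀ σ p, lett D x z σ p ∈ A := by
    rintro σ ⟨i, k⟩
    unfold lett
    induction k with
    | zero => cases i <;> simp [hx, hz]
    | succ k ih => rw [Function.iterate_succ_apply']; exact hAD _ ih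
  have hall' : ∀ i : Fin 5, ∃ k, (some i, k) ∈ l := by
    intro i
    simpa using hall i
  choose k hk using hall'
  have hk5 : ∑ i, k i ≤ 5 := by
    classical
    refine le_of_le_of_eq ?_ hs
    rw [← List.sum_toFinset _ hnd.of_map]
    have : ∑ i, k i = ∑ p ∈ Finset.univ.image (fun i : Fin 5 => (some i, k i)), p.2 := by
      rw [Finset.sum_image]
      intro a _ b _ h
      simpa using congrArg Prod.fst h
    rw [this]
    apply Finset.sum_le_sum_of_subset
    intro p hp
    simp only [Finset.mem_image, Finset.mem_univ, true_and] at hp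
    obtain ⟨i, rfl⟩ := hp
    simpa using hk i
  cases l with
  | nil => simp at hs
  | cons hd tl =>
    obtain ⟨i, j, hij, hi, hj, hkk⟩ := pigeon k hk5 hd.1
    have hi' : (some i, k i) ∈ tl := by
      rcases List.mem_cons.1 (hk i) with h | h
      · exact absurd (congrArg Prod.fst h) hi
      · exact h
    have hj' : (some j, k i) ∈ tl := by
      rcases List.mem_cons.1 (hk j) with h | h
      · exact absurd (congrArg Prod.fst h) hj
      · rw [hkk]; exact h
    have hnd' : (tl.map Prod.fst).Nodup := (List.nodup_cons.1 hnd).2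
    have huniq : ∀ p ∈ tl, ∀ q ∈ tl, p.1 = q.1 → p = q :=
      fun p hp q hq h => List.inj_on_of_nodup_map hnd' hp hq h
    let sw : Option (Fin 5) × ℕ → Option (Fin 5) × ℕ :=
      fun p => (p.1.map (Equiv.swap i j), p.2)
    have hsw : ∀ p, sw (sw p) = p := by
      rintro ⟨_ | p, n⟩ <;> simp [sw]
    have hswlett : ∀ σ p, lett D x z (σ * Equiv.swap i j) p = lett D x z σ (sw p) := by
      rintro σ ⟨_ | p, n⟩ <;> simp [sw, lett]
    have hmem : ∀ p ∈ tl, sw p ∈ tl := by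
      rintro ⟨_ | p, n⟩ hp
      · simpa [sw] using hp
      · by_cases h1 : p = i
        · subst h1
          have := huniq _ hp _ hi' rfl
          rw [this]
          simpa [sw] using hj'
        · by_cases h2 : p = j
          · subst h2
            have := huniq _ hp _ hj' rfl
            rw [this]
            simpa [sw] using hi'
          · simpa [sw, Equiv.swap_apply_of_ne_of_ne h1 h2] using hp
    have hperm : (tl.map sw).Perm tl := by
      rw [List.perm_ext_iff_of_nodup
        ((hnd'.of_map).map (Function.Involutive.injective hsw)) hnd'.of_map]
      intro p
      constructor
      · intro hp
        obtain ⟨q, hq, rfl⟩ := List.mem_map.1 hp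
        exact hmem q hq
      · intro hp
        exact List.mem_map.2 ⟨sw p, hmem p hp, hsw p⟩
    have hhd : sw hd = hd := by
      rcases hd with ⟨_ | p, n⟩
      · simp [sw]
      · have h1 : p ≠ i := fun h => hi (by simp [h])
        have h2 : p ≠ j := fun h => hj (by simp [h])
        simp [sw, Equiv.swap_apply_of_ne_of_ne h1 h2]
    have key : ∀ σ, ((hd :: tl).map (lett D x z (σ * Equiv.swap i j))).prod =
        ((hd :: tl).map (lett D x z σ)).prod := by
      intro σ
      simp only [List.map_cons, List.prod_cons, hswlett, hhd]
      have := prod_perm A hA hc (hperm.map (lett D x z σ))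
        (by
          intro a ha
          obtain ⟨q, _, rfl⟩ := List.mem_map.1 ha
          exact hlett _ _) _ (hlett σ hd)
      have e : lett D x z (σ * Equiv.swap i j) = fun p => lett D x z σ (sw p) :=
        funext (hswlett σ)
      rw [e]
      simpa [Function.comp_def] using this
    refine Finset.sum_involution (fun σ _ => σ * Equiv.swap i j) ?_ ?_ ?_ ?_
    · intro σ _
      rw [key, Equiv.Perm.sign_mul, Equiv.Perm.sign_swap hij]
      simp
    · intro σ _ _ h
      have := mul_eq_left.1 h
      exact hij (Equiv.swap_eq_one_iff.1 this)
    · intro σ _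
      exact Finset.mem_univ _
    · intro σ _
      simp [mul_assoc]

theorem std_six (D : R →+ R) (hD : ∀ a b, D (a * b) = D a * b + a * D b)
    (x : Fin 5 → R) (z : R)
    (A : Set R) (hA : ∀ a ∈ A, ∀ b ∈ A, a * b ∈ A) (hAD : ∀ a ∈ A, D a ∈ A)
    (hc : ∀ a ∈ A, ∀ b ∈ A, ∀ c ∈ A, a * (b * c) = a * (c * b))
    (hx : ∀ i, x i ∈ A) (hz : z ∈ A) (br : R → R → R) (hbr : ∀ a b, br a b = D b * a - D a * b) :
    ∑ σ : Equiv.Perm (Fin 5), ((Equiv.Perm.sign σ : ℤˣ) : ℤ) •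
      br (x (σ 0)) (br (x (σ 1)) (br (x (σ 2)) (br (x (σ 3)) (br (x (σ 4)) z)))) = 0 := by
  have h0 : (fun _ => z) ∈ wspan D x z {none} 0 :=
    AddSubgroup.subset_closure ⟨[(none, 0)], rfl, rfl, by funext σ; simp [lett]⟩
  have h5 := wspan_bracket D hD x z 0 (wspan_bracket D hD x z 1 (wspan_bracket D hD x z 2
    (wspan_bracket D hD x z 3 (wspan_bracket D hD x z 4 h0))))
  simp only [← hbr] at h5
  have gen : ∀ F ∈ wspan D x z (some 0 ::ₘ some 1 ::ₘ some 2 ::ₘ some 3 ::ₘ some 4 ::ₘ {none})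
      (0 + 1 + 1 + 1 + 1 + 1),
      ∑ σ : Equiv.Perm (Fin 5), ((Equiv.Perm.sign σ : ℤˣ) : ℤ) • F σ = 0 := by
    intro F hF
    unfold wspan at hF
    induction hF using AddSubgroup.closure_induction with
    | mem F h =>
      obtain ⟨l, h1, h2, rfl⟩ := h
      refine word_alt D x z A hA hAD hc hx hz l ?_ ?_ h2
      · rw [← Multiset.coe_nodup, h1]; decide
      · intro i
        rw [← Multiset.mem_coe, h1]
        fin_cases i <;> decide
    | zero => simp
    | add F G _ _ hF hG => simp only [Pi.add_apply, smul_add, Finset.sum_add_distrib, hF, hG, add_zero]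
    | neg F _ hF => simp only [Pi.neg_apply, smul_neg, Finset.sum_neg_distrib, hF, neg_zero]
  exact gen _ h5

end Helpers

theorem polyS_comm {K : Type*} [Field K]
    {S : Type*} [NonUnitalRing S] [Module K S] [SMulCommClass K S S] [IsScalarTower K S S]
    (hS : ∀ s u v : S, s * (u * v - v * u) = 0)
    (a b c : Polynomial (Unitization K S)) (ha : ∀ n, (a.coeff n).fst = 0)
    (hb : ∀ n, (b.coeff n).fst = 0) (hc : ∀ n, (c.coeff n).fst = 0) :
    a * (b * c) = a * (c * b) := by
  have key : ∀ p q r : Unitization K S, p.fst = 0 → q.fst = 0 → r.fst = 0 →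
      p * (q * r) = p * (r * q) := by
    intro p q r hp hq hr
    have h := hS p.snd q.snd r.snd
    rw [mul_sub, sub_eq_zero] at h
    ext <;> simp [hp, hq, hr, h]
  ext1 n
  rw [Polynomial.coeff_mul, Polynomial.coeff_mul]
  refine Finset.sum_congr rfl fun i _ => ?_
  rw [Polynomial.coeff_mul, Polynomial.coeff_mul, Finset.mul_sum, Finset.mul_sum,
    ← Finset.Nat.sum_antidiagonal_swap]
  refine Finset.sum_congr rfl fun j _ => ?_
  exact key _ _ _ (ha _) (hb _) (hc _)

theorem polyS_coe_sum {K : Type*} [Field K]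
    {S : Type*} [NonUnitalRing S] [Module K S] [SMulCommClass K S S] [IsScalarTower K S S]
    {ι : Type*} (s : Finset ι) (e : ι → ℤ) (B : ι → polyS K S) :
    ((∑ i ∈ s, e i • B i : polyS K S) : Polynomial (Unitization K S)) =
      ∑ i ∈ s, e i • (B i : Polynomial (Unitization K S)) := by
  let f := NonUnitalSubalgebraClass.subtype (polyS K S)
  refine (map_sum f _ _).trans ?_
  exact Finset.sum_congr rfl fun σ _ => map_zsmul f _ _

/-- If `S[S,S] = 0`, then the Lie algebra `(S[t], ⟨a,b⟩ = b′a − a′b)` satisfies the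
standard identity of degree 6:
`St₆(x₁,…,x₅,z) = ∑_{σ ∈ Sym(5)} sgn(σ) ⟨x_{σ(1)}, ⟨…, ⟨x_{σ(5)}, z⟩…⟩⟩ = 0`. -/
theorem statement17 {K : Type*} [Field K] [CharZero K]
    {S : Type*} [NonUnitalRing S] [Module K S] [SMulCommClass K S S] [IsScalarTower K S S]
    (hS : ∀ s u v : S, s * (u * v - v * u) = 0)
    (x : Fin 5 → polyS K S) (z : polyS K S) :
    ∑ σ : Equiv.Perm (Fin 5), ((Equiv.Perm.sign σ : ℤˣ) : ℤ) •
        polyS.bracket (x (σ 0)) (polyS.bracket (x (σ 1)) (polyS.bracket (x (σ 2))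
          (polyS.bracket (x (σ 3)) (polyS.bracket (x (σ 4)) z)))) = 0 := by
  have h := std_six (R := Polynomial (Unitization K S))
    (Polynomial.derivative (R := Unitization K S)).toAddMonoidHom
    (fun a b => Polynomial.derivative_mul)
    (fun i => (x i : Polynomial (Unitization K S))) (z : Polynomial (Unitization K S))
    (polyS K S : Set (Polynomial (Unitization K S)))
    (fun a ha b hb => (polyS K S).mul_mem ha hb)
    (fun a ha => (polyS.deriv (⟨a, ha⟩ : polyS K S)).2)
    (fun a ha b hb c hc => polyS_comm hS a b c ha hb hc)
    (fun i => (x i).2) z.2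
    (fun a b => Polynomial.derivative b * a - Polynomial.derivative a * b) (fun a b => rfl)
  apply Subtype.ext
  rw [polyS_coe_sum]
  refine Eq.trans ?_ h
  refine Finset.sum_congr rfl fun σ _ => ?_
  rfl
end
end

section
/- If S[S,S] = 0 and [S,S]S³ = 0 (i.e. (uv − vu)s₁s₂s₃ = 0 for all u, v, s₁, s₂, s₃ ∈ S), then the Lie algebra (S[t], ⟨a,b⟩ := b′a − a′b) satisfies the standard identity of degree 5: St₅(x₁,…,x₄,z) = ∑_{σ ∈ Sym(4)} sgn(σ) ⟨x_{σ(1)}, ⟨x_{σ(2)}, ⟨x_{σ(3)}, ⟨x_{σ(4)}, z⟩⟩⟩⟩ = 0 for all x₁, …, x₄, z ∈ S[t]. -/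
noncomputable section

variable (K : Type*) [Field K] [CharZero K]
variable (S : Type*) [NonUnitalRing S] [Module K S] [SMulCommClass K S S] [IsScalarTower K S S]

variable {K S}

theorem aux_alt {R : Type*} [NonUnitalRing R] (w : Equiv.Perm (Fin 4) → R) (i j : Fin 4)
    (hij : i ≠ j) (h : ∀ σ, w (σ * Equiv.swap i j) = w σ) :
    ∑ σ : Equiv.Perm (Fin 4), ((Equiv.Perm.sign σ : ℤˣ) : ℤ) • w σ = 0 := by
  refine Finset.sum_involution (fun σ _ => σ * Equiv.swap i j) ?_ ?_ ?_ ?_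
  · intro σ _
    simp [h, Equiv.Perm.sign_swap hij]
  · intro σ _ _ h'
    exact hij (Equiv.swap_eq_one_iff.1 (mul_eq_left.1 h'))
  · intro σ _
    exact Finset.mem_univ _
  · intro σ _
    simp [mul_assoc]

set_option maxHeartbeats 4000000 in
theorem aux_main {R : Type*} [NonUnitalRing R] (D : R → R)
    (Dsub : ∀ a b, D (a - b) = D a - D b)
    (Dadd : ∀ a b, D (a + b) = D a + D b)
    (Dmul : ∀ a b, D (a * b) = D a * b + a * D b)
    (h1 : ∀ a b c : R, a * b * c = a * c * b)
    (h2 : ∀ a b c d e : R, a * b * c * d * e = b * a * c * d * e)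
    (br : R → R → R) (hbr : ∀ a b, br a b = D b * a - D a * b)
    (x : Fin 4 → R) (z : R) :
    ∑ σ : Equiv.Perm (Fin 4), ((Equiv.Perm.sign σ : ℤˣ) : ℤ) •
        br (x (σ 0)) (br (x (σ 1)) (br (x (σ 2)) (br (x (σ 3)) z))) = 0 := by
  have e01 : Equiv.swap (0 : Fin 4) 1 0 = 1 ∧ Equiv.swap (0 : Fin 4) 1 1 = 0 ∧
    Equiv.swap (0 : Fin 4) 1 2 = 2 ∧ Equiv.swap (0 : Fin 4) 1 3 = 3 := by decide
  have e02 : Equiv.swap (0 : Fin 4) 2 0 = 2 ∧ Equiv.swap (0 : Fin 4) 2 1 = 1 ∧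
    Equiv.swap (0 : Fin 4) 2 2 = 0 ∧ Equiv.swap (0 : Fin 4) 2 3 = 3 := by decide
  have e03 : Equiv.swap (0 : Fin 4) 3 0 = 3 ∧ Equiv.swap (0 : Fin 4) 3 1 = 1 ∧
    Equiv.swap (0 : Fin 4) 3 2 = 2 ∧ Equiv.swap (0 : Fin 4) 3 3 = 0 := by decide
  have e12 : Equiv.swap (1 : Fin 4) 2 0 = 0 ∧ Equiv.swap (1 : Fin 4) 2 1 = 2 ∧
    Equiv.swap (1 : Fin 4) 2 2 = 1 ∧ Equiv.swap (1 : Fin 4) 2 3 = 3 := by decide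
  have e13 : Equiv.swap (1 : Fin 4) 3 0 = 0 ∧ Equiv.swap (1 : Fin 4) 3 1 = 3 ∧
    Equiv.swap (1 : Fin 4) 3 2 = 2 ∧ Equiv.swap (1 : Fin 4) 3 3 = 1 := by decide
  have e23 : Equiv.swap (2 : Fin 4) 3 0 = 0 ∧ Equiv.swap (2 : Fin 4) 3 1 = 1 ∧
    Equiv.swap (2 : Fin 4) 3 2 = 3 ∧ Equiv.swap (2 : Fin 4) 3 3 = 2 := by decide
  have a0 : ∀ f g : Equiv.Perm (Fin 4) → R,
      ∑ σ, ((Equiv.Perm.sign σ : ℤˣ) : ℤ) • f σ = 0 →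
      ∑ σ, ((Equiv.Perm.sign σ : ℤˣ) : ℤ) • g σ = 0 →
      ∑ σ, ((Equiv.Perm.sign σ : ℤˣ) : ℤ) • (f σ + g σ) = 0 := by
    intro f g hf hg
    simp only [smul_add, Finset.sum_add_distrib, hf, hg, add_zero]
  have s0 : ∀ f g : Equiv.Perm (Fin 4) → R,
      ∑ σ, ((Equiv.Perm.sign σ : ℤˣ) : ℤ) • f σ = 0 →
      ∑ σ, ((Equiv.Perm.sign σ : ℤˣ) : ℤ) • g σ = 0 →
      ∑ σ, ((Equiv.Perm.sign σ : ℤˣ) : ℤ) • (f σ - g σ) = 0 := by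
    intro f g hf hg
    simp only [smul_sub, Finset.sum_sub_distrib, hf, hg, sub_zero]
  have t01 : ∀ a b c d e : R, a * b * c * d * e = b * a * c * d * e := by
    intro a b c d e; simp only [h1, h2]
  have t02 : ∀ a b c d e : R, a * b * c * d * e = c * b * a * d * e := by
    intro a b c d e; simp only [h1, h2]
  have t03 : ∀ a b c d e : R, a * b * c * d * e = d * b * c * a * e := by
    intro a b c d e; simp only [h1, h2]
  have t04 : ∀ a b c d e : R, a * b * c * d * e = e * b * c * d * a := by
    intro a b c d e; simp only [h1, h2]
  have t12 : ∀ a b c d e : R, a * b * c * d * e = a * c * b * d * e := by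
    intro a b c d e; simp only [h1, h2]
  have t13 : ∀ a b c d e : R, a * b * c * d * e = a * d * c * b * e := by
    intro a b c d e; simp only [h1, h2]
  have t14 : ∀ a b c d e : R, a * b * c * d * e = a * e * c * d * b := by
    intro a b c d e; simp only [h1, h2]
  have t23 : ∀ a b c d e : R, a * b * c * d * e = a * b * d * c * e := by
    intro a b c d e; simp only [h1, h2]
  have t24 : ∀ a b c d e : R, a * b * c * d * e = a * b * e * d * c := by
    intro a b c d e; simp only [h1, h2]
  have t34 : ∀ a b c d e : R, a * b * c * d * e = a * b * c * e * d := by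
    intro a b c d e; simp only [h1, h2]
  have n01 : (0 : Fin 4) ≠ 1 := by decide
  have n02 : (0 : Fin 4) ≠ 2 := by decide
  have n03 : (0 : Fin 4) ≠ 3 := by decide
  have n12 : (1 : Fin 4) ≠ 2 := by decide
  have n13 : (1 : Fin 4) ≠ 3 := by decide
  have n23 : (2 : Fin 4) ≠ 3 := by decide
  simp only [hbr, Dsub, Dadd, Dmul, mul_add, add_mul, mul_sub, sub_mul, ← mul_assoc]
  repeat' first
    | with_reducible refine a0 _ _ ?_ ?_
    | with_reducible refine s0 _ _ ?_ ?_
  all_goals first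
    | (with_reducible refine aux_alt _ 0 1 n01 fun σ => ?_
       simp only [Equiv.Perm.mul_apply, e01]
       with_reducible first
         | exact t01 _ _ _ _ _
         | exact t02 _ _ _ _ _
         | exact t03 _ _ _ _ _
         | exact t04 _ _ _ _ _
         | exact t12 _ _ _ _ _
         | exact t13 _ _ _ _ _
         | exact t14 _ _ _ _ _
         | exact t23 _ _ _ _ _
         | exact t24 _ _ _ _ _
         | exact t34 _ _ _ _ _)
    | (with_reducible refine aux_alt _ 0 2 n02 fun σ => ?_
       simp only [Equiv.Perm.mul_apply, e02]
       with_reducible first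
         | exact t01 _ _ _ _ _
         | exact t02 _ _ _ _ _
         | exact t03 _ _ _ _ _
         | exact t04 _ _ _ _ _
         | exact t12 _ _ _ _ _
         | exact t13 _ _ _ _ _
         | exact t14 _ _ _ _ _
         | exact t23 _ _ _ _ _
         | exact t24 _ _ _ _ _
         | exact t34 _ _ _ _ _)
    | (with_reducible refine aux_alt _ 0 3 n03 fun σ => ?_
       simp only [Equiv.Perm.mul_apply, e03]
       with_reducible first
         | exact t01 _ _ _ _ _
         | exact t02 _ _ _ _ _
         | exact t03 _ _ _ _ _
         | exact t04 _ _ _ _ _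
         | exact t12 _ _ _ _ _
         | exact t13 _ _ _ _ _
         | exact t14 _ _ _ _ _
         | exact t23 _ _ _ _ _
         | exact t24 _ _ _ _ _
         | exact t34 _ _ _ _ _)
    | (with_reducible refine aux_alt _ 1 2 n12 fun σ => ?_
       simp only [Equiv.Perm.mul_apply, e12]
       with_reducible first
         | exact t01 _ _ _ _ _
         | exact t02 _ _ _ _ _
         | exact t03 _ _ _ _ _
         | exact t04 _ _ _ _ _
         | exact t12 _ _ _ _ _
         | exact t13 _ _ _ _ _
         | exact t14 _ _ _ _ _
         | exact t23 _ _ _ _ _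
         | exact t24 _ _ _ _ _
         | exact t34 _ _ _ _ _)
    | (with_reducible refine aux_alt _ 1 3 n13 fun σ => ?_
       simp only [Equiv.Perm.mul_apply, e13]
       with_reducible first
         | exact t01 _ _ _ _ _
         | exact t02 _ _ _ _ _
         | exact t03 _ _ _ _ _
         | exact t04 _ _ _ _ _
         | exact t12 _ _ _ _ _
         | exact t13 _ _ _ _ _
         | exact t14 _ _ _ _ _
         | exact t23 _ _ _ _ _
         | exact t24 _ _ _ _ _
         | exact t34 _ _ _ _ _)
    | (with_reducible refine aux_alt _ 2 3 n23 fun σ => ?_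
       simp only [Equiv.Perm.mul_apply, e23]
       with_reducible first
         | exact t01 _ _ _ _ _
         | exact t02 _ _ _ _ _
         | exact t03 _ _ _ _ _
         | exact t04 _ _ _ _ _
         | exact t12 _ _ _ _ _
         | exact t13 _ _ _ _ _
         | exact t14 _ _ _ _ _
         | exact t23 _ _ _ _ _
         | exact t24 _ _ _ _ _
         | exact t34 _ _ _ _ _)

section
variable {K : Type*} [Field K]
variable {S : Type*} [NonUnitalRing S] [Module K S] [SMulCommClass K S S] [IsScalarTower K S S]

theorem polyS_ind (P : polyS K S → Prop) (h0 : P 0) (hadd : ∀ p q, P p → P q → P (p + q))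
    (hs : ∀ n s, P (polyS.single n s)) (p : polyS K S) : P p := by
  have key : p = ∑ n ∈ (p : Polynomial (Unitization K S)).support,
      polyS.single n ((p : Polynomial (Unitization K S)).coeff n).snd := by
    apply Subtype.ext
    rw [AddSubmonoidClass.coe_finsetSum]
    conv_lhs => rw [Polynomial.as_sum_support (p : Polynomial (Unitization K S))]
    refine Finset.sum_congr rfl fun n _ => ?_
    have h : ((p : Polynomial (Unitization K S)).coeff n).fst = 0 := p.2 n
    simp only [polyS.single]
    congr 1
    ext <;> simp [h]
  rw [key]
  exact Finset.sum_induction _ P hadd h0 fun n _ => hs n _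

theorem polyS_single_mul (m n : ℕ) (a b : S) :
    (polyS.single m a * polyS.single n b : polyS K S) = polyS.single (m + n) (a * b) := by
  apply Subtype.ext
  simp [polyS.single, Polynomial.monomial_mul_monomial]

theorem polyS_bracket_eq (a b : polyS K S) :
    polyS.bracket a b = polyS.deriv b * a - polyS.deriv a * b := rfl

end

/-- If `S[S,S] = 0` and `[S,S]S³ = 0`, then the Lie algebra
`(S[t], ⟨a,b⟩ = b′a − a′b)` satisfies the standard identity of degree 5:
`St₅(x₁,…,x₄,z) = ∑_{σ ∈ Sym(4)} sgn(σ) ⟨x_{σ(1)}, ⟨…, ⟨x_{σ(4)}, z⟩…⟩⟩ = 0`. -/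
theorem statement18 {K : Type*} [Field K] [CharZero K]
    {S : Type*} [NonUnitalRing S] [Module K S] [SMulCommClass K S S] [IsScalarTower K S S]
    (hS : ∀ s u v : S, s * (u * v - v * u) = 0)
    (hS' : ∀ u v s₁ s₂ s₃ : S, (u * v - v * u) * s₁ * s₂ * s₃ = 0)
    (x : Fin 4 → polyS K S) (z : polyS K S) :
    ∑ σ : Equiv.Perm (Fin 4), ((Equiv.Perm.sign σ : ℤˣ) : ℤ) •
        polyS.bracket (x (σ 0)) (polyS.bracket (x (σ 1)) (polyS.bracket (x (σ 2))
          (polyS.bracket (x (σ 3)) z))) = 0 := by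
  have k1 : ∀ s u v : S, s * u * v = s * v * u := by
    intro s u v
    have := hS s u v
    rwa [mul_sub, sub_eq_zero, ← mul_assoc, ← mul_assoc] at this
  have k2 : ∀ a b c d e : S, a * b * c * d * e = b * a * c * d * e := by
    intro a b c d e
    have := hS' a b c d e
    rwa [sub_mul, sub_mul, sub_mul, sub_eq_zero] at this
  refine aux_main (R := polyS K S) polyS.deriv ?_ ?_ ?_ ?_ ?_ polyS.bracket polyS_bracket_eq x z
  · intro a b
    apply Subtype.ext
    simp [polyS.deriv]
  · intro a b
    apply Subtype.ext
    simp [polyS.deriv]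
  · intro a b
    apply Subtype.ext
    simp [polyS.deriv, Polynomial.derivative_mul]
  · intro a b c
    induction a using polyS_ind with
    | h0 => simp only [zero_mul]
    | hadd p q hp hq => simp only [add_mul, hp, hq]
    | hs i a =>
    induction b using polyS_ind with
    | h0 => simp only [zero_mul, mul_zero]
    | hadd p q hp hq => simp only [add_mul, mul_add, hp, hq]
    | hs j b =>
    induction c using polyS_ind with
    | h0 => simp only [zero_mul, mul_zero]
    | hadd p q hp hq => simp only [add_mul, mul_add, hp, hq]
    | hs k c =>
    simp only [polyS_single_mul]
    rw [k1 a b c, add_right_comm]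
  · intro a b c d e
    induction a using polyS_ind with
    | h0 => simp only [zero_mul, mul_zero]
    | hadd p q hp hq => simp only [add_mul, mul_add, hp, hq]
    | hs i a =>
    induction b using polyS_ind with
    | h0 => simp only [zero_mul, mul_zero]
    | hadd p q hp hq => simp only [add_mul, mul_add, hp, hq]
    | hs j b =>
    induction c using polyS_ind with
    | h0 => simp only [zero_mul, mul_zero]
    | hadd p q hp hq => simp only [add_mul, mul_add, hp, hq]
    | hs k c =>
    induction d using polyS_ind with
    | h0 => simp only [zero_mul, mul_zero]
    | hadd p q hp hq => simp only [add_mul, mul_add, hp, hq]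
    | hs l d =>
    induction e using polyS_ind with
    | h0 => simp only [mul_zero]
    | hadd p q hp hq => simp only [mul_add, hp, hq]
    | hs m e =>
    simp only [polyS_single_mul]
    rw [k2 a b c d e, add_comm i j]


end
end
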